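/- Let q be a probability distribution on S_n and let ε be the diamond-norm distance between the uniform twirl Ū and the q-weighted twirl Ū_q on (ℂ^d)^⊗n. Then (1/n) H(q) ≥ log d − 2 d log(n+1)/n − (1/n) f(ε), where f(x) = 2x log(d^n − 1) + 2 H₂(x) and H₂ is the binary entropy. -/

import Mathlib

open Matrix BigOperators
open scoped Kronecker ComplexOrder

noncomputable section

/-- The permutation unitary `U^π` on `(ℂ^d)^⊗n ≅ ℂ^([d]^n)`, acting on the standard
product basis by `U^π |e_𝐱⟩ = |e_{𝐱 ∘ π}⟩`. -/
def permU (d n : ℕ) (π : Equiv.Perm (Fin n)) :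
    Matrix (Fin n → Fin d) (Fin n → Fin d) ℂ :=
  Matrix.of fun w x => if w = x ∘ ⇑π then 1 else 0

open Classical in
/-- Von Neumann entropy (base 2) of a matrix, via eigenvalues of its Hermitian part
(junk value 0 if not Hermitian). -/
noncomputable def vNEntropy {m : Type*} [Fintype m] [DecidableEq m]
    (ρ : Matrix m m ℂ) : ℝ :=
  if h : ρ.IsHermitian then ∑ i, -(h.eigenvalues i * Real.logb 2 (h.eigenvalues i)) else 0

/-- Trace norm of a square complex matrix: sum of singular values. -/
noncomputable def traceNorm {m : Type*} [Fintype m] [DecidableEq m]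
    (a : Matrix m m ℂ) : ℝ :=
  ∑ i, Real.sqrt ((Matrix.posSemidef_conjTranspose_mul_self a).1.eigenvalues i)

/-- `id ⊗ Φ` acting on block matrices. -/
noncomputable def idTensor {m ι : Type*} [Fintype ι]
    (Φ : Matrix ι ι ℂ → Matrix ι ι ℂ)
    (a : Matrix (m × ι) (m × ι) ℂ) : Matrix (m × ι) (m × ι) ℂ :=
  Matrix.of fun p q => Φ (Matrix.of fun x y => a (p.1, x) (q.1, y)) p.2 q.2

/-- Diamond norm: supremum over ancilla dimensions of the trace norm of
`(id ⊗ Φ)(a)` over inputs `a` of trace norm one. -/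
noncomputable def diamondNorm {ι : Type*} [Fintype ι] [DecidableEq ι]
    (Φ : Matrix ι ι ℂ → Matrix ι ι ℂ) : ℝ :=
  ⨆ m : ℕ, ⨆ a : {a : Matrix (Fin (m + 1) × ι) (Fin (m + 1) × ι) ℂ // traceNorm a = 1},
    traceNorm (idTensor Φ a.1)

section TraceNorm

open scoped Matrix.Norms.L2Operator

variable {m : Type*} [Fintype m] [DecidableEq m]

theorem Matrix.IsHermitian.conjTranspose_eigenvectorUnitary_mul_mul {A : Matrix m m ℂ}
    (hA : A.IsHermitian) :
    (hA.eigenvectorUnitary : Matrix m m ℂ)ᴴ * A * (hA.eigenvectorUnitary : Matrix m m ℂ) =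
      diagonal fun i => (hA.eigenvalues i : ℂ) := by
  have h := hA.conjStarAlgAut_star_eigenvectorUnitary
  rw [Unitary.conjStarAlgAut_star_apply] at h
  exact h

theorem norm_unitary_le_one (U : unitary (Matrix m m ℂ)) : ‖(U : Matrix m m ℂ)‖ ≤ 1 := by
  have h : ‖(U : Matrix m m ℂ)‖ * ‖(U : Matrix m m ℂ)‖ = ‖(1 : Matrix m m ℂ)‖ := by
    rw [← Matrix.l2_opNorm_conjTranspose_mul_self]
    congr 1
    exact Unitary.coe_star_mul_self U
  have h1 : ‖(1 : Matrix m m ℂ)‖ ≤ 1 := by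
    rw [← Matrix.diagonal_one, Matrix.l2_opNorm_diagonal]
    exact (pi_norm_le_iff_of_nonneg zero_le_one).2 fun i => by simp
  nlinarith [norm_nonneg (U : Matrix m m ℂ)]

theorem norm_mul_apply_le (X B : Matrix m m ℂ) (i j : m) :
    ‖(X * B) i j‖ ≤ ‖X‖ * Real.sqrt ((Bᴴ * B) j j).re := by
  have h := Matrix.l2_opNorm_mulVec X (WithLp.toLp 2 fun k => B k j)
  have h1 : ‖(WithLp.toLp 2 fun k => B k j : EuclideanSpace ℂ m)‖ =
      Real.sqrt ((Bᴴ * B) j j).re := by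
    rw [EuclideanSpace.norm_eq]
    congr 1
    simp only [Matrix.mul_apply, Matrix.conjTranspose_apply, Complex.re_sum]
    refine Finset.sum_congr rfl fun k _ => ?_
    rw [← Complex.normSq_eq_norm_sq, Complex.normSq_apply]
    simp
  rw [h1] at h
  refine le_trans ?_ h
  refine le_trans (le_of_eq ?_) (PiLp.norm_apply_le _ i)
  rfl

/-- A contraction never pairs to more than the trace norm. -/
theorem norm_trace_mul_le_traceNorm {W : Matrix m m ℂ} (hW : ‖W‖ ≤ 1) (a : Matrix m m ℂ) :
    ‖(W * a).trace‖ ≤ traceNorm a := by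
  have hA := (Matrix.posSemidef_conjTranspose_mul_self a).1
  set V : Matrix m m ℂ := (hA.eigenvectorUnitary : Matrix m m ℂ) with hV
  have hVn : ‖V‖ ≤ 1 := norm_unitary_le_one _
  have hVV : V * Vᴴ = 1 := Unitary.coe_mul_star_self hA.eigenvectorUnitary
  have hdiag : (a * V)ᴴ * (a * V) = diagonal fun i => (hA.eigenvalues i : ℂ) := by
    rw [← hA.conjTranspose_eigenvectorUnitary_mul_mul, Matrix.conjTranspose_mul]
    simp only [Matrix.mul_assoc, hV]
  have htr : (W * a).trace = ((Vᴴ * W) * (a * V)).trace := by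
    rw [Matrix.mul_assoc, Matrix.trace_mul_comm Vᴴ, Matrix.mul_assoc, Matrix.mul_assoc, hVV,
      Matrix.mul_one]
  have hX : ‖Vᴴ * W‖ ≤ 1 := by
    refine (Matrix.l2_opNorm_mul _ _).trans ?_
    rw [Matrix.l2_opNorm_conjTranspose]
    exact mul_le_one₀ hVn (norm_nonneg _) hW
  rw [htr, Matrix.trace, traceNorm]
  refine (norm_sum_le _ _).trans (Finset.sum_le_sum fun i _ => ?_)
  refine (norm_mul_apply_le _ _ i i).trans ?_
  rw [hdiag, Matrix.diagonal_apply_eq, Complex.ofReal_re]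
  exact mul_le_of_le_one_left (Real.sqrt_nonneg _) hX

/-- The trace norm is attained by a contraction. -/
theorem exists_trace_mul_eq_traceNorm (a : Matrix m m ℂ) :
    ∃ W : Matrix m m ℂ, ‖W‖ ≤ 1 ∧ (W * a).trace = (traceNorm a : ℂ) := by
  have hP := Matrix.posSemidef_conjTranspose_mul_self a
  have hA := hP.1
  set V : Matrix m m ℂ := (hA.eigenvectorUnitary : Matrix m m ℂ) with hV
  have hVn : ‖V‖ ≤ 1 := norm_unitary_le_one _
  have hdiag : Vᴴ * (aᴴ * a) * V = diagonal fun i => (hA.eigenvalues i : ℂ) :=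
    hA.conjTranspose_eigenvectorUnitary_mul_mul
  set D : Matrix m m ℂ := diagonal fun i => (((Real.sqrt (hA.eigenvalues i))⁻¹ : ℝ) : ℂ) with hD
  have hDH : Dᴴ = D := by
    rw [hD, Matrix.diagonal_conjTranspose]
    congr 1
    ext i
    simp
  have hnonneg : ∀ i, 0 ≤ hA.eigenvalues i := hP.eigenvalues_nonneg
  have hX : ‖D * Vᴴ * aᴴ‖ ≤ 1 := by
    have h : ‖D * Vᴴ * aᴴ‖ * ‖D * Vᴴ * aᴴ‖ ≤ 1 := by
      rw [← Matrix.l2_opNorm_conjTranspose (D * Vᴴ * aᴴ),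
        ← Matrix.l2_opNorm_conjTranspose_mul_self]
      have : (D * Vᴴ * aᴴ)ᴴᴴ * (D * Vᴴ * aᴴ)ᴴ = D * (Vᴴ * (aᴴ * a) * V) * D := by
        simp only [Matrix.conjTranspose_mul, Matrix.conjTranspose_conjTranspose, hDH,
          Matrix.mul_assoc]
      rw [this, hdiag, hD, Matrix.diagonal_mul_diagonal, Matrix.diagonal_mul_diagonal,
        Matrix.l2_opNorm_diagonal]
      refine (pi_norm_le_iff_of_nonneg zero_le_one).2 fun i => ?_
      rcases (hnonneg i).eq_or_lt with h0 | h0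
      · simp [← h0]
      · have hs : 0 < Real.sqrt (hA.eigenvalues i) := Real.sqrt_pos.2 h0
        rw [← Complex.ofReal_mul, ← Complex.ofReal_mul, Complex.norm_real]
        have : (Real.sqrt (hA.eigenvalues i))⁻¹ * hA.eigenvalues i *
            (Real.sqrt (hA.eigenvalues i))⁻¹ = 1 := by
          have h2 := Real.mul_self_sqrt h0.le
          field_simp
          nlinarith
        rw [this]
        simp
    nlinarith [norm_nonneg (D * Vᴴ * aᴴ)]
  refine ⟨V * (D * Vᴴ * aᴴ), ?_, ?_⟩
  · exact (Matrix.l2_opNorm_mul _ _).trans (mul_le_one₀ hVn (norm_nonneg _) hX)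
  · have : (V * (D * Vᴴ * aᴴ) * a).trace = (D * (Vᴴ * (aᴴ * a) * V)).trace := by
      rw [Matrix.mul_assoc V, Matrix.trace_mul_comm V]
      simp only [Matrix.mul_assoc]
    rw [this, hdiag, hD, Matrix.diagonal_mul_diagonal, Matrix.trace_diagonal, traceNorm,
      Complex.ofReal_sum]
    refine Finset.sum_congr rfl fun i _ => ?_
    rw [← Complex.ofReal_mul]
    congr 1
    rw [inv_mul_eq_div, Real.div_sqrt]

theorem traceNorm_nonneg (a : Matrix m m ℂ) : 0 ≤ traceNorm a :=
  Finset.sum_nonneg fun _ _ => Real.sqrt_nonneg _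

theorem traceNorm_sum_smul_conj_le {κ : Type*} (s : Finset κ) (c : κ → ℂ)
    (u : κ → Matrix m m ℂ) (hu : ∀ k, ‖u k‖ ≤ 1) (a : Matrix m m ℂ) :
    traceNorm (∑ k ∈ s, c k • (u k * a * (u k)ᴴ)) ≤ (∑ k ∈ s, ‖c k‖) * traceNorm a := by
  obtain ⟨W, hW, h⟩ := exists_trace_mul_eq_traceNorm (∑ k ∈ s, c k • (u k * a * (u k)ᴴ))
  have h1 : traceNorm (∑ k ∈ s, c k • (u k * a * (u k)ᴴ)) =
      ‖(W * ∑ k ∈ s, c k • (u k * a * (u k)ᴴ)).trace‖ := by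
    rw [h, Complex.norm_real, Real.norm_of_nonneg (traceNorm_nonneg _)]
  rw [h1, Finset.mul_sum, Matrix.trace_sum, Finset.sum_mul]
  refine (norm_sum_le _ _).trans (Finset.sum_le_sum fun k _ => ?_)
  rw [Matrix.mul_smul, Matrix.trace_smul, norm_smul]
  refine mul_le_mul_of_nonneg_left ?_ (norm_nonneg _)
  have h2 : (W * (u k * a * (u k)ᴴ)).trace = (((u k)ᴴ * W * u k) * a).trace := by
    rw [← Matrix.mul_assoc, Matrix.trace_mul_comm _ (u k)ᴴ]
    simp only [Matrix.mul_assoc]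
  rw [h2]
  refine norm_trace_mul_le_traceNorm ?_ a
  refine (Matrix.l2_opNorm_mul _ _).trans (mul_le_one₀ ?_ (norm_nonneg _) (hu k))
  refine (Matrix.l2_opNorm_mul _ _).trans (mul_le_one₀ ?_ (norm_nonneg _) hW)
  rw [Matrix.l2_opNorm_conjTranspose]
  exact hu k

theorem traceNorm_zero : traceNorm (0 : Matrix m m ℂ) = 0 := by
  obtain ⟨W, -, h⟩ := exists_trace_mul_eq_traceNorm (0 : Matrix m m ℂ)
  simpa using h.symm

theorem traceNorm_single_self (x : m) : traceNorm (Matrix.single x x (1 : ℂ)) = 1 := by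
  have hsq : (Matrix.single x x (1 : ℂ))ᴴ * Matrix.single x x 1 = Matrix.single x x 1 := by simp
  apply le_antisymm
  · obtain ⟨W, hW, h⟩ := exists_trace_mul_eq_traceNorm (Matrix.single x x (1 : ℂ))
    have h1 : traceNorm (Matrix.single x x (1 : ℂ)) = ‖(W * Matrix.single x x 1).trace‖ := by
      rw [h, Complex.norm_real, Real.norm_of_nonneg (traceNorm_nonneg _)]
    rw [h1, Matrix.trace_mul_single]
    have h2 := norm_mul_apply_le W 1 x x
    simp only [Matrix.conjTranspose_one, Matrix.one_apply_eq, Complex.one_re,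
      Real.sqrt_one, mul_one] at h2
    simpa using h2.trans hW
  · have h1 : ‖(1 : Matrix m m ℂ)‖ ≤ 1 := by
      simpa using norm_unitary_le_one (1 : unitary (Matrix m m ℂ))
    simpa using norm_trace_mul_le_traceNorm h1 (Matrix.single x x (1 : ℂ))

end TraceNorm

section DiamondNorm

open scoped Matrix.Norms.L2Operator

variable {ι κ : Type*} [Fintype ι] [Fintype κ]

theorem norm_le_one_of_conjTranspose_mul_self {m : Type*} [Fintype m] [DecidableEq m]
    {u : Matrix m m ℂ} (hu : uᴴ * u = 1) : ‖u‖ ≤ 1 :=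
  norm_unitary_le_one ⟨u, Unitary.mem_iff.2 ⟨hu, mul_eq_one_comm.1 hu⟩⟩

theorem idTensor_sum_smul_conj {m : Type*} [Fintype m] [DecidableEq m] (c : κ → ℂ)
    (u : κ → Matrix ι ι ℂ) (a : Matrix (m × ι) (m × ι) ℂ) :
    idTensor (fun b => ∑ k, c k • (u k * b * (u k)ᴴ)) a =
      ∑ k, c k • (((1 : Matrix m m ℂ) ⊗ₖ u k) * a * ((1 : Matrix m m ℂ) ⊗ₖ u k)ᴴ) := by
  ext ⟨i, x⟩ ⟨j, y⟩
  simp [idTensor, Matrix.sum_apply, Matrix.mul_apply, Fintype.sum_prod_type,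
    Matrix.one_apply, apply_ite (starRingEnd ℂ), Finset.sum_ite_irrel]

variable [DecidableEq ι]

theorem traceNorm_idTensor_sum_smul_conj_le {m : Type*} [Fintype m] [DecidableEq m] (c : κ → ℂ)
    (u : κ → Matrix ι ι ℂ) (hu : ∀ k, (u k)ᴴ * u k = 1) (a : Matrix (m × ι) (m × ι) ℂ) :
    traceNorm (idTensor (fun b => ∑ k, c k • (u k * b * (u k)ᴴ)) a) ≤
      (∑ k, ‖c k‖) * traceNorm a := by
  rw [idTensor_sum_smul_conj]
  refine traceNorm_sum_smul_conj_le _ _ _ (fun k => ?_) a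
  refine norm_le_one_of_conjTranspose_mul_self ?_
  rw [Matrix.conjTranspose_kronecker, ← Matrix.mul_kronecker_mul, hu]
  simp

theorem diamondNorm_sum_smul_conj_le (c : κ → ℂ) (u : κ → Matrix ι ι ℂ)
    (hu : ∀ k, (u k)ᴴ * u k = 1) :
    diamondNorm (fun b => ∑ k, c k • (u k * b * (u k)ᴴ)) ≤ ∑ k, ‖c k‖ := by
  have h0 : 0 ≤ ∑ k, ‖c k‖ := Finset.sum_nonneg fun _ _ => norm_nonneg _
  refine Real.iSup_le (fun m => Real.iSup_le (fun a => ?_) h0) h0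
  simpa [a.2] using traceNorm_idTensor_sum_smul_conj_le c u hu a.1

theorem traceNorm_idTensor_le_diamondNorm (c : κ → ℂ) (u : κ → Matrix ι ι ℂ)
    (hu : ∀ k, (u k)ᴴ * u k = 1) (m : ℕ) (a : Matrix (Fin (m + 1) × ι) (Fin (m + 1) × ι) ℂ)
    (ha : traceNorm a = 1) :
    traceNorm (idTensor (fun b => ∑ k, c k • (u k * b * (u k)ᴴ)) a) ≤
      diamondNorm (fun b => ∑ k, c k • (u k * b * (u k)ᴴ)) := by
  have h0 : 0 ≤ ∑ k, ‖c k‖ := Finset.sum_nonneg fun _ _ => norm_nonneg _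
  have hb (l : ℕ) (a : {a : Matrix (Fin (l + 1) × ι) (Fin (l + 1) × ι) ℂ // traceNorm a = 1}) :
      traceNorm (idTensor (fun b => ∑ k, c k • (u k * b * (u k)ᴴ)) a.1) ≤ ∑ k, ‖c k‖ := by
    simpa [a.2] using traceNorm_idTensor_sum_smul_conj_le c u hu a.1
  have hin := le_ciSup (f := fun a : {a : Matrix (Fin (m + 1) × ι) (Fin (m + 1) × ι) ℂ //
      traceNorm a = 1} => traceNorm (idTensor (fun b => ∑ k, c k • (u k * b * (u k)ᴴ)) a.1))
    ⟨_, Set.forall_mem_range.2 (hb m)⟩ ⟨a, ha⟩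
  exact hin.trans (le_ciSup (f := fun l : ℕ => ⨆ a : {a : Matrix (Fin (l + 1) × ι)
      (Fin (l + 1) × ι) ℂ // traceNorm a = 1},
      traceNorm (idTensor (fun b => ∑ k, c k • (u k * b * (u k)ᴴ)) a.1))
    ⟨_, Set.forall_mem_range.2 fun l => Real.iSup_le (hb l) h0⟩ m)

/-- Feeding a basis state and measuring in the basis: the diamond norm bounds the bias of every
event `A`. -/
theorem norm_sum_diag_le_diamondNorm (c : κ → ℂ) (u : κ → Matrix ι ι ℂ)
    (hu : ∀ k, (u k)ᴴ * u k = 1) (x : ι) (A : Finset ι) :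
    ‖∑ w ∈ A, (∑ k, c k • (u k * Matrix.single x x 1 * (u k)ᴴ) : Matrix ι ι ℂ) w w‖ ≤
      diamondNorm (fun b => ∑ k, c k • (u k * b * (u k)ᴴ)) := by
  refine le_trans ?_ (traceNorm_idTensor_le_diamondNorm c u hu 0
    (Matrix.single (0, x) (0, x) 1) (traceNorm_single_self _))
  have hW : ‖(diagonal fun p : Fin (0 + 1) × ι => if p.2 ∈ A then (1 : ℂ) else 0)‖ ≤ 1 := by
    rw [Matrix.l2_opNorm_diagonal]
    refine (pi_norm_le_iff_of_nonneg zero_le_one).2 fun i => ?_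
    split_ifs <;> simp
  refine le_trans (le_of_eq ?_) (norm_trace_mul_le_traceNorm hW _)
  congr 1
  have hs : (Matrix.of fun y z => Matrix.single ((0 : Fin (0 + 1)), x) ((0 : Fin (0 + 1)), x)
      (1 : ℂ) (0, y) (0, z)) = Matrix.single x x 1 := by
    ext y z
    simp [Matrix.single_apply]
  rw [Matrix.trace, Fintype.sum_prod_type]
  simp only [Matrix.diag_apply, Matrix.diagonal_mul, idTensor, Matrix.of_apply]
  rw [Fin.sum_univ_one, hs]
  simp

end DiamondNorm

section PermUnitary

variable {d n : ℕ}

theorem permU_conjTranspose_mul_self (π : Equiv.Perm (Fin n)) :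
    (permU d n π)ᴴ * permU d n π = 1 := by
  ext x y
  have h : y ∘ π = x ∘ π ↔ x = y := π.surjective.injective_comp_right.eq_iff.trans eq_comm
  simp [permU, Matrix.mul_apply, Matrix.one_apply, h]

theorem permU_mul_single_mul_diag (π : Equiv.Perm (Fin n)) (x w : Fin n → Fin d) :
    (permU d n π * Matrix.single x x 1 * (permU d n π)ᴴ :
      Matrix (Fin n → Fin d) (Fin n → Fin d) ℂ) w w = if w = x ∘ π then 1 else 0 := by
  simp only [permU, Matrix.mul_apply, Matrix.single_apply, ite_and, Matrix.of_apply,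
    Matrix.conjTranspose_apply]
  rw [Finset.sum_eq_single x (fun y _ hy => by simp [hy.symm]) (by simp)]
  simp

/-- The twirl difference as a single signed mixture of permutation conjugations. -/
theorem twirl_sub_eq_sum (q : Equiv.Perm (Fin n) → ℝ) :
    (fun b : Matrix (Fin n → Fin d) (Fin n → Fin d) ℂ =>
      ((n.factorial : ℂ))⁻¹ •
          (∑ π : Equiv.Perm (Fin n), permU d n π * b * (permU d n π)ᴴ)
        - ∑ π : Equiv.Perm (Fin n), (q π : ℂ) • (permU d n π * b * (permU d n π)ᴴ)) =
    fun b => ∑ π : Equiv.Perm (Fin n),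
      (((n.factorial : ℝ)⁻¹ - q π : ℝ) : ℂ) • (permU d n π * b * (permU d n π)ᴴ) := by
  funext b
  rw [Finset.smul_sum, ← Finset.sum_sub_distrib]
  refine Finset.sum_congr rfl fun π _ => ?_
  rw [← sub_smul]
  push_cast
  rfl

theorem sum_inv_factorial (n : ℕ) :
    ∑ _π : Equiv.Perm (Fin n), ((n.factorial : ℝ))⁻¹ = 1 := by
  rw [Finset.sum_const, Finset.card_univ, Fintype.card_perm, Fintype.card_fin, nsmul_eq_mul]
  exact mul_inv_cancel₀ (by exact_mod_cast n.factorial_ne_zero)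

theorem diamondNorm_twirl_le_two (q : Equiv.Perm (Fin n) → ℝ) (hq0 : ∀ π, 0 ≤ q π)
    (hq1 : ∑ π, q π = 1) :
    diamondNorm (fun b : Matrix (Fin n → Fin d) (Fin n → Fin d) ℂ =>
      ∑ π : Equiv.Perm (Fin n),
      (((n.factorial : ℝ)⁻¹ - q π : ℝ) : ℂ) • (permU d n π * b * (permU d n π)ᴴ)) ≤ 2 := by
  refine (diamondNorm_sum_smul_conj_le _ _ permU_conjTranspose_mul_self).trans ?_
  calc ∑ π : Equiv.Perm (Fin n), ‖(((n.factorial : ℝ)⁻¹ - q π : ℝ) : ℂ)‖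
      ≤ ∑ π : Equiv.Perm (Fin n), ((n.factorial : ℝ)⁻¹ + q π) := by
        refine Finset.sum_le_sum fun π _ => ?_
        rw [Complex.norm_real, Real.norm_eq_abs, abs_le]
        have : 0 ≤ (n.factorial : ℝ)⁻¹ := by positivity
        constructor <;> linarith [hq0 π]
    _ = 2 := by rw [Finset.sum_add_distrib, sum_inv_factorial, hq1]; norm_num

/-- The diamond distance of the twirls bounds the statistical bias of the random word `x ∘ π`. -/
theorem sum_bias_le_diamondNorm (q : Equiv.Perm (Fin n) → ℝ) (x : Fin n → Fin d)
    (A : Finset (Fin n → Fin d)) :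
    ∑ w ∈ A, ((∑ π : Equiv.Perm (Fin n), if w = x ∘ π then q π else 0) -
        ∑ π : Equiv.Perm (Fin n), if w = x ∘ π then (n.factorial : ℝ)⁻¹ else 0) ≤
      diamondNorm (fun b : Matrix (Fin n → Fin d) (Fin n → Fin d) ℂ =>
        ∑ π : Equiv.Perm (Fin n),
        (((n.factorial : ℝ)⁻¹ - q π : ℝ) : ℂ) • (permU d n π * b * (permU d n π)ᴴ)) := by
  refine le_trans ?_ (norm_sum_diag_le_diamondNorm _ _ permU_conjTranspose_mul_self x A)
  simp only [Matrix.sum_apply, Matrix.smul_apply, permU_mul_single_mul_diag, smul_eq_mul]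
  have h : (∑ w ∈ A, ∑ π : Equiv.Perm (Fin n), (((n.factorial : ℝ)⁻¹ - q π : ℝ) : ℂ) *
      (if w = x ∘ π then 1 else 0)) =
      ((-∑ w ∈ A, ((∑ π : Equiv.Perm (Fin n), if w = x ∘ π then q π else 0) -
        ∑ π : Equiv.Perm (Fin n), if w = x ∘ π then (n.factorial : ℝ)⁻¹ else 0) : ℝ) : ℂ) := by
    rw [← Finset.sum_neg_distrib, Complex.ofReal_sum]
    refine Finset.sum_congr rfl fun w _ => ?_
    rw [← Finset.sum_sub_distrib, ← Finset.sum_neg_distrib, Complex.ofReal_sum]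
    refine Finset.sum_congr rfl fun π _ => ?_
    split_ifs <;> simp
  rw [h, Complex.norm_real, norm_neg]
  exact Real.le_norm_self _

theorem permU_eq_one (h : d = 1 ∨ n = 1) (π : Equiv.Perm (Fin n)) : permU d n π = 1 := by
  ext w x
  have : x ∘ π = x := by
    rcases h with rfl | rfl
    · exact Subsingleton.elim _ _
    · rw [Subsingleton.elim π 1]; rfl
  simp [permU, this, Matrix.one_apply]

theorem diamondNorm_twirl_eq_zero (h : d = 1 ∨ n = 1) (q : Equiv.Perm (Fin n) → ℝ)
    (hq1 : ∑ π, q π = 1) :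
    diamondNorm (fun b : Matrix (Fin n → Fin d) (Fin n → Fin d) ℂ =>
      ∑ π : Equiv.Perm (Fin n),
      (((n.factorial : ℝ)⁻¹ - q π : ℝ) : ℂ) • (permU d n π * b * (permU d n π)ᴴ)) = 0 := by
  have hz : (fun b : Matrix (Fin n → Fin d) (Fin n → Fin d) ℂ =>
      ∑ π : Equiv.Perm (Fin n),
      (((n.factorial : ℝ)⁻¹ - q π : ℝ) : ℂ) • (permU d n π * b * (permU d n π)ᴴ)) =
      fun _ => 0 := by
    funext b
    simp only [permU_eq_one h, Matrix.conjTranspose_one, Matrix.one_mul, Matrix.mul_one]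
    rw [← Finset.sum_smul, ← Complex.ofReal_sum, Finset.sum_sub_distrib, sum_inv_factorial, hq1]
    simp
  rw [hz, diamondNorm]
  have (m : ℕ) (a : Matrix (Fin (m + 1) × (Fin n → Fin d)) (Fin (m + 1) × (Fin n → Fin d)) ℂ) :
      idTensor (fun _ : Matrix (Fin n → Fin d) (Fin n → Fin d) ℂ => 0) a = 0 := by
    ext; simp [idTensor]
  simp [this, traceNorm_zero]

end PermUnitary

section Entropy

/-- If the law `p` of `f` under `q` is compared with the uniform law on the range of `f`, the
entropy of `q` is at least `log K - T (1 + log K)`, where `K` is the size of the range and `T` is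
the excess mass of `p` over the uniform law. -/
theorem exists_log_card_sub_le_entropy {G X : Type*} [Fintype G] [Fintype X] [DecidableEq X]
    (f : G → X) (q : G → ℝ) (hq0 : ∀ g, 0 ≤ q g) (hq1 : ∑ g, q g = 1) :
    ∃ A ⊆ Finset.univ.image f, ∃ T : ℝ,
      T = ∑ w ∈ A, ((∑ g, if w = f g then q g else 0) - ((Finset.univ.image f).card : ℝ)⁻¹) ∧
      0 ≤ T ∧ T ≤ 1 ∧
      Real.log (Finset.univ.image f).card - T * (1 + Real.log (Finset.univ.image f).card) ≤
        ∑ g, -(q g * Real.log (q g)) := by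
  set K : ℝ := ((Finset.univ.image f).card : ℝ) with hK
  set p : X → ℝ := fun w => ∑ g, if w = f g then q g else 0 with hp
  have hne : Nonempty G := by
    by_contra h
    rw [not_nonempty_iff] at h
    simp at hq1
  have hK1 : 1 ≤ K := by
    rw [hK]
    exact_mod_cast Finset.card_pos.2 (Finset.univ_nonempty.image f)
  have hK0 : 0 < K := by linarith
  have hlogK : 0 ≤ Real.log K := Real.log_nonneg hK1
  have hp0 : ∀ w, 0 ≤ p w := fun w => Finset.sum_nonneg fun g _ => by
    split_ifs
    exacts [hq0 g, le_rfl]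
  have hqp : ∀ g, q g ≤ p (f g) := fun g => by
    have := Finset.single_le_sum (f := fun h => if f g = f h then q h else 0)
      (fun h _ => by split_ifs; exacts [hq0 h, le_rfl]) (Finset.mem_univ g)
    simpa using this
  have hpsum (F : X → ℝ) : ∑ g, q g * F (f g) = ∑ w, p w * F w := by
    simp only [hp, Finset.sum_mul]
    rw [Finset.sum_comm]
    simp [ite_mul]
  have hp1 : ∑ w, p w = 1 := by simpa [hq1] using (hpsum fun _ => 1).symm
  have hpO : ∀ w, w ∉ Finset.univ.image f → p w = 0 := fun w hw =>
    Finset.sum_eq_zero fun g _ => if_neg fun h : w = f g =>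
      hw (h.symm ▸ Finset.mem_image_of_mem f (Finset.mem_univ g))
  have hple : ∀ w, p w ≤ 1 := fun w =>
    hp1 ▸ Finset.single_le_sum (fun w _ => hp0 w) (Finset.mem_univ w)
  set A := (Finset.univ.image f).filter fun w => K⁻¹ < p w with hA
  refine ⟨A, Finset.filter_subset _ _, _, rfl, ?_, ?_, ?_⟩
  · exact Finset.sum_nonneg fun w hw => sub_nonneg.2 (Finset.mem_filter.1 hw).2.le
  · calc ∑ w ∈ A, (p w - K⁻¹) ≤ ∑ w ∈ A, p w :=
          Finset.sum_le_sum fun w _ => sub_le_self _ (inv_nonneg.2 hK0.le)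
      _ ≤ ∑ w, p w := Finset.sum_le_univ_sum_of_nonneg hp0
      _ = 1 := hp1
  · have h1 : ∑ g, q g * -Real.log (p (f g)) ≤ ∑ g, -(q g * Real.log (q g)) := by
      refine Finset.sum_le_sum fun g _ => ?_
      rcases (hq0 g).eq_or_lt with h | h
      · simp [← h]
      · have := mul_le_mul_of_nonneg_left (Real.log_le_log h (hqp g)) h.le
        linarith
    rw [hpsum fun w => -Real.log (p w)] at h1
    have h2 : Real.log K - ∑ w, p w * -Real.log (p w) = ∑ w, p w * Real.log (K * p w) := by
      have : Real.log K = ∑ w, p w * Real.log K := by rw [← Finset.sum_mul, hp1, one_mul]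
      rw [this, ← Finset.sum_sub_distrib]
      refine Finset.sum_congr rfl fun w _ => ?_
      rcases (hp0 w).eq_or_lt with h | h
      · simp [← h]
      · rw [Real.log_mul hK0.ne' h.ne']
        ring
    have h3 : ∑ w, p w * Real.log (K * p w) ≤ ∑ w ∈ A, (p w - K⁻¹) * (1 + Real.log K) := by
      refine le_trans (b := ∑ w ∈ A, p w * Real.log (K * p w)) ?_ ?_
      · rw [← Finset.sum_add_sum_compl A]
        refine add_le_of_nonpos_right (Finset.sum_nonpos fun w hw => ?_)
        by_cases hwO : w ∈ Finset.univ.image f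
        · have hle : p w ≤ K⁻¹ := by
            by_contra! h
            exact Finset.mem_compl.1 hw (Finset.mem_filter.2 ⟨hwO, h⟩)
          refine mul_nonpos_of_nonneg_of_nonpos (hp0 w) (Real.log_nonpos ?_ ?_)
          · exact mul_nonneg hK0.le (hp0 w)
          · calc K * p w ≤ K * K⁻¹ := mul_le_mul_of_nonneg_left hle hK0.le
              _ = 1 := mul_inv_cancel₀ hK0.ne'
        · simp [hpO w hwO]
      · refine Finset.sum_le_sum fun w hw => ?_
        have hlt := (Finset.mem_filter.1 hw).2
        have hpos : 0 < p w := (inv_pos.2 hK0).trans hlt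
        have h4 : K⁻¹ * Real.log (K * p w) ≤ p w - K⁻¹ := by
          have := mul_le_mul_of_nonneg_left
            (Real.log_le_sub_one_of_pos (mul_pos hK0 hpos)) (inv_nonneg.2 hK0.le)
          rwa [mul_sub, inv_mul_cancel_left₀ hK0.ne', mul_one] at this
        have h5 : (p w - K⁻¹) * Real.log (K * p w) ≤ (p w - K⁻¹) * Real.log K := by
          refine mul_le_mul_of_nonneg_left (Real.log_le_log (mul_pos hK0 hpos) ?_)
            (sub_nonneg.2 hlt.le)
          exact mul_le_of_le_one_right hK0.le (hple w)
        linarith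
    rw [← Finset.sum_mul] at h3
    linarith

end Entropy

section Words

variable {d n : ℕ}

/-- The uniform distribution on permutations induces the uniform distribution on rearrangements. -/
theorem sum_inv_factorial_eq_inv_card (x w : Fin n → Fin d)
    (hw : w ∈ Finset.univ.image fun π : Equiv.Perm (Fin n) => x ∘ π) :
    (∑ π : Equiv.Perm (Fin n), if w = x ∘ π then (n.factorial : ℝ)⁻¹ else 0) =
      ((Finset.univ.image fun π : Equiv.Perm (Fin n) => x ∘ π).card : ℝ)⁻¹ := by
  set O := Finset.univ.image fun π : Equiv.Perm (Fin n) => x ∘ π with hO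
  have hconst : ∀ v ∈ O, (∑ π : Equiv.Perm (Fin n), if v = x ∘ π then (n.factorial : ℝ)⁻¹ else 0)
      = ∑ π : Equiv.Perm (Fin n), if x = x ∘ π then (n.factorial : ℝ)⁻¹ else 0 := by
    intro v hv
    obtain ⟨σ, -, rfl⟩ := Finset.mem_image.1 hv
    rw [← Equiv.sum_comp (Equiv.mulRight σ)]
    refine Finset.sum_congr rfl fun π _ => ?_
    have h : x ∘ σ = x ∘ (π * σ : Equiv.Perm (Fin n)) ↔ x = x ∘ π := by
      rw [Equiv.Perm.coe_mul, ← Function.comp_assoc]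
      exact σ.surjective.injective_comp_right.eq_iff
    simp only [Equiv.coe_mulRight, h]
  have htot : ∑ v ∈ O, (∑ π : Equiv.Perm (Fin n), if v = x ∘ π then (n.factorial : ℝ)⁻¹ else 0)
      = 1 := by
    rw [Finset.sum_comm, ← sum_inv_factorial n]
    refine Finset.sum_congr rfl fun π _ => ?_
    rw [Finset.sum_ite_eq', if_pos (Finset.mem_image_of_mem _ (Finset.mem_univ π))]
  rw [Finset.sum_congr rfl hconst, Finset.sum_const, nsmul_eq_mul, ← hconst w hw] at htot
  exact eq_inv_of_mul_eq_one_right htot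

/-- Some type class of words is at least as large as the average one. -/
theorem exists_pow_le_card_rearrangements_mul (hd : 0 < d) :
    ∃ x : Fin n → Fin d,
      d ^ n ≤ (Finset.univ.image fun π : Equiv.Perm (Fin n) => x ∘ π).card * (n + 1) ^ d := by
  classical
  have : Nonempty (Fin d) := ⟨⟨0, hd⟩⟩
  by_contra! hlt
  let t : (Fin n → Fin d) → Fin d → Fin (n + 1) := fun x i =>
    ⟨(Finset.univ.filter fun j => x j = i).card, by
      have := Finset.card_le_univ (Finset.univ.filter fun j => x j = i)
      rw [Fintype.card_fin] at this
      lia⟩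
  have hfib : ∀ x y : Fin n → Fin d, t y = t x →
      y ∈ Finset.univ.image fun π : Equiv.Perm (Fin n) => x ∘ π := by
    intro x y h
    have e : ∀ i, {j // y j = i} ≃ {j // x j = i} := fun i => by
      refine Fintype.equivOfCardEq ?_
      rw [Fintype.card_subtype, Fintype.card_subtype]
      exact congrArg Fin.val (congrFun h i)
    refine Finset.mem_image.2 ⟨Equiv.ofFiberEquiv e, Finset.mem_univ _, ?_⟩
    funext j
    exact Equiv.ofFiberEquiv_map e j
  obtain ⟨c, hc⟩ := Fintype.exists_le_card_fiber_of_nsmul_le_card (M := ℚ) t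
    (b := (d : ℚ) ^ n / (n + 1) ^ d) (by
      simp only [Fintype.card_pi, Fintype.card_fin, Finset.prod_const, Finset.card_univ,
        nsmul_eq_mul]
      push_cast
      rw [mul_div_cancel₀]
      positivity)
  have hpos : (0 : ℚ) < (d : ℚ) ^ n / (n + 1) ^ d := by
    have : (0 : ℚ) < d := by exact_mod_cast hd
    positivity
  obtain ⟨x, hx⟩ := Finset.card_pos.1 (Nat.cast_pos.1 (hpos.trans_le hc))
  have hsub : (Finset.univ.filter fun y => t y = c) ⊆
      Finset.univ.image fun π : Equiv.Perm (Fin n) => x ∘ π := fun y hy =>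
    hfib x y ((Finset.mem_filter.1 hy).2.trans (Finset.mem_filter.1 hx).2.symm)
  have h1 : (d : ℚ) ^ n / (n + 1) ^ d ≤
      (Finset.univ.image fun π : Equiv.Perm (Fin n) => x ∘ π).card :=
    hc.trans (Nat.cast_le.2 (Finset.card_le_card hsub))
  rw [div_le_iff₀ (by positivity)] at h1
  exact (hlt x).not_ge (by exact_mod_cast h1)

end Words

section Assembly

variable {d n : ℕ}

/-- The entropy bound in natural logarithms, with a total-variation type error `T`. -/
theorem exists_entropy_bound (hd : 0 < d) (q : Equiv.Perm (Fin n) → ℝ) (hq0 : ∀ π, 0 ≤ q π)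
    (hq1 : ∑ π, q π = 1) :
    ∃ T : ℝ, 0 ≤ T ∧ T ≤ 1 ∧
      T ≤ diamondNorm (fun b : Matrix (Fin n → Fin d) (Fin n → Fin d) ℂ =>
        ∑ π : Equiv.Perm (Fin n),
        (((n.factorial : ℝ)⁻¹ - q π : ℝ) : ℂ) • (permU d n π * b * (permU d n π)ᴴ)) ∧
      n * Real.log d - d * Real.log (n + 1) - T * (1 + n * Real.log d) ≤
        ∑ π, -(q π * Real.log (q π)) := by
  obtain ⟨x, hx⟩ := exists_pow_le_card_rearrangements_mul (n := n) hd
  obtain ⟨A, hA, T, hT, hT0, hT1, hH⟩ :=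
    exists_log_card_sub_le_entropy (fun π : Equiv.Perm (Fin n) => x ∘ π) q hq0 hq1
  refine ⟨T, hT0, hT1, ?_, ?_⟩
  · refine le_trans (le_of_eq ?_) (sum_bias_le_diamondNorm q x A)
    rw [hT]
    exact Finset.sum_congr rfl fun w hw => by rw [sum_inv_factorial_eq_inv_card x w (hA hw)]
  · set k := (Finset.univ.image fun π : Equiv.Perm (Fin n) => x ∘ π).card with hk
    have hkpos : 0 < k := Finset.card_pos.2 (Finset.univ_nonempty.image _)
    have hkle : k ≤ d ^ n := by
      simpa using Finset.card_le_univ (Finset.univ.image fun π : Equiv.Perm (Fin n) => x ∘ π)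
    have hkR : (0 : ℝ) < k := by exact_mod_cast hkpos
    have hdR : (0 : ℝ) < d := by exact_mod_cast hd
    have h1 : Real.log k ≤ n * Real.log d := by
      rw [← Real.log_pow]
      exact Real.log_le_log hkR (by exact_mod_cast hkle)
    have h2 : n * Real.log d ≤ Real.log k + d * Real.log (n + 1) := by
      rw [← Real.log_pow, ← Real.log_pow, ← Real.log_mul hkR.ne' (by positivity)]
      exact Real.log_le_log (by positivity) (by exact_mod_cast hx)
    have h3 : T * (1 + Real.log k) ≤ T * (1 + n * Real.log d) :=
      mul_le_mul_of_nonneg_left (by linarith) hT0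
    linarith

/-- The correction terms dominate the excess-mass terms. -/
theorem correction_le_of_two_le (hd : 2 ≤ d) (hn : 2 ≤ n) {ε T H : ℝ} (hT0 : 0 ≤ T)
    (hT1 : T ≤ 1) (hTε : T ≤ ε) (hε2 : ε ≤ 2) (hH0 : 0 ≤ H)
    (hH : n * Real.log d - d * Real.log (n + 1) - T * (1 + n * Real.log d) ≤ H) :
    n * Real.log d - 2 * (d * Real.log (n + 1)) - (2 * (ε * Real.log ((d : ℝ) ^ n - 1))
      + 2 * (-(ε * Real.log ε) - (1 - ε) * Real.log (1 - ε))) ≤ H := by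
  have hdR : (2 : ℝ) ≤ d := by exact_mod_cast hd
  have hnR : (2 : ℝ) ≤ n := by exact_mod_cast hn
  have hN : (4 : ℝ) ≤ (d : ℝ) ^ n := by
    calc (4 : ℝ) = 2 ^ 2 := by norm_num
      _ ≤ (d : ℝ) ^ 2 := by gcongr
      _ ≤ (d : ℝ) ^ n := pow_le_pow_right₀ (by linarith) hn
  have hl2 := Real.log_two_gt_d9
  have hl3 : 3 * Real.log 2 ≤ 2 * Real.log 3 := by
    have := Real.log_le_log (by norm_num) (show (2 : ℝ) ^ 3 ≤ 3 ^ 2 by norm_num)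
    rw [Real.log_pow, Real.log_pow] at this
    exact_mod_cast this
  have hn3 : Real.log 3 ≤ Real.log (n + 1) := Real.log_le_log (by norm_num) (by linarith)
  have hdn : 2 * Real.log 3 ≤ d * Real.log (n + 1) :=
    mul_le_mul hdR hn3 (by linarith) (by linarith)
  have hM : n * Real.log d + Real.log 2 ≤ 2 * Real.log ((d : ℝ) ^ n - 1) := by
    have h := Real.log_le_log (by positivity)
      (show (d : ℝ) ^ n * 2 ≤ ((d : ℝ) ^ n - 1) ^ 2 by nlinarith)
    rw [Real.log_mul (by positivity) two_ne_zero, Real.log_pow, Real.log_pow] at h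
    exact_mod_cast h
  have hL : 0 ≤ n * Real.log d := mul_nonneg (by linarith) (Real.log_nonneg (by linarith))
  have hε0 : 0 ≤ ε := hT0.trans hTε
  rcases le_or_gt ε 1 with h1 | h1
  · have e1 : ε * Real.log ε ≤ 0 :=
      mul_nonpos_of_nonneg_of_nonpos hε0 (Real.log_nonpos hε0 h1)
    have e2 : (1 - ε) * Real.log (1 - ε) ≤ 0 :=
      mul_nonpos_of_nonneg_of_nonpos (by linarith)
        (Real.log_nonpos (by linarith) (by linarith))
    have e3 : T * (n * Real.log d) ≤ ε * (2 * Real.log ((d : ℝ) ^ n - 1)) :=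
      mul_le_mul hTε (by linarith) hL hε0
    linarith
  · have e1 : ε * Real.log ε ≤ 2 * Real.log 2 :=
      mul_le_mul hε2 (Real.log_le_log (by linarith) hε2) (Real.log_nonneg h1.le) (by norm_num)
    have e2 : (1 - ε) * Real.log (1 - ε) ≤ 1 := by
      have hpos : 0 < ε - 1 := by linarith
      have h := mul_le_mul_of_nonneg_left (Real.one_sub_inv_le_log_of_pos hpos) hpos.le
      rw [mul_sub, mul_inv_cancel₀ hpos.ne'] at h
      rw [show 1 - ε = -(ε - 1) by ring, Real.log_neg_eq_log]
      linarith
    have e3 : 1 * (2 * Real.log ((d : ℝ) ^ n - 1)) ≤ ε * (2 * Real.log ((d : ℝ) ^ n - 1)) :=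
      mul_le_mul_of_nonneg_right h1.le (by linarith)
    linarith

end Assembly

/-- Approximate version of the entropy lower bound: if `ε` is the diamond-norm
distance of the `q`-weighted twirl from the uniform twirl, then
`(1/n) H(q) ≥ log d − 2d log(n+1)/n − (1/n) f(ε)` where
`f(x) = 2x log(dⁿ − 1) + 2H₂(x)` and `H₂` is the binary entropy. -/
theorem approx_design_entropy_lower_bound (d n : ℕ) (hd : 0 < d) (hn : 0 < n)
    (q : Equiv.Perm (Fin n) → ℝ) (hq0 : ∀ π, 0 ≤ q π)
    (hq1 : ∑ π : Equiv.Perm (Fin n), q π = 1)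
    (ε : ℝ)
    (hε : ε = diamondNorm (fun b : Matrix (Fin n → Fin d) (Fin n → Fin d) ℂ =>
      ((n.factorial : ℂ))⁻¹ •
          (∑ π : Equiv.Perm (Fin n), permU d n π * b * (permU d n π)ᴴ)
        - ∑ π : Equiv.Perm (Fin n),
            (q π : ℂ) • (permU d n π * b * (permU d n π)ᴴ))) :
    Real.logb 2 d - 2 * d * Real.logb 2 (n + 1) / n
        - (1 / n) * (2 * ε * Real.logb 2 ((d : ℝ) ^ n - 1)
            + 2 * (-(ε * Real.logb 2 ε) - (1 - ε) * Real.logb 2 (1 - ε)))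
      ≤ (1 / n) * ∑ π : Equiv.Perm (Fin n), -(q π * Real.logb 2 (q π)) := by
  rw [twirl_sub_eq_sum] at hε
  have hH0 : 0 ≤ ∑ π, -(q π * Real.log (q π)) := Finset.sum_nonneg fun π _ => by
    have : q π ≤ 1 := hq1 ▸ Finset.single_le_sum (fun π _ => hq0 π) (Finset.mem_univ π)
    exact neg_nonneg.2 (mul_nonpos_of_nonneg_of_nonpos (hq0 π) (Real.log_nonpos (hq0 π) this))
  obtain ⟨T, hT0, hT1, hTε, hH⟩ := exists_entropy_bound (d := d) hd q hq0 hq1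
  rw [← hε] at hTε
  have key : n * Real.log d - 2 * (d * Real.log (n + 1)) -
      (2 * (ε * Real.log ((d : ℝ) ^ n - 1))
        + 2 * (-(ε * Real.log ε) - (1 - ε) * Real.log (1 - ε))) ≤
      ∑ π, -(q π * Real.log (q π)) := by
    by_cases h : d = 1 ∨ n = 1
    · rw [diamondNorm_twirl_eq_zero h q hq1] at hε
      obtain rfl : T = 0 := le_antisymm (hε ▸ hTε) hT0
      have : 0 ≤ d * Real.log ((n : ℝ) + 1) :=
        mul_nonneg d.cast_nonneg (Real.log_nonneg (by linarith [n.cast_nonneg (α := ℝ)]))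
      subst hε
      simp only [zero_mul, mul_zero, sub_zero, Real.log_one, neg_zero, add_zero] at hH ⊢
      linarith
    · push Not at h
      exact correction_le_of_two_le (by lia) (by lia) hT0 hT1 hTε
        (hε ▸ diamondNorm_twirl_le_two q hq0 hq1) hH0 hH
  have hl2 : 0 < Real.log 2 := Real.log_pos one_lt_two
  have hnR : (0 : ℝ) < n := by exact_mod_cast hn
  have hL : Real.logb 2 d - 2 * d * Real.logb 2 (n + 1) / n
        - (1 / n) * (2 * ε * Real.logb 2 ((d : ℝ) ^ n - 1)
            + 2 * (-(ε * Real.logb 2 ε) - (1 - ε) * Real.logb 2 (1 - ε))) =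
      (1 / (n * Real.log 2)) * (n * Real.log d - 2 * (d * Real.log (n + 1)) -
      (2 * (ε * Real.log ((d : ℝ) ^ n - 1))
        + 2 * (-(ε * Real.log ε) - (1 - ε) * Real.log (1 - ε)))) := by
    simp only [Real.logb]
    field_simp
  have hR : (1 / n) * ∑ π : Equiv.Perm (Fin n), -(q π * Real.logb 2 (q π)) =
      (1 / (n * Real.log 2)) * ∑ π, -(q π * Real.log (q π)) := by
    rw [Finset.mul_sum, Finset.mul_sum]
    refine Finset.sum_congr rfl fun π _ => ?_
    rw [Real.logb]
    field_simp
  rw [hL, hR]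
  exact mul_le_mul_of_nonneg_left key (by positivity)
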